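/- Let b ∈ 𝔽^d with minimal A-annihilating polynomial m_b. Every A-{b} characteristic vector, i.e., every g ∈ Z(A;b) with (A − I)g ∈ span{b}, is a scalar multiple of m̂_b(A)b. In particular, if m_b(1) = 0, then every nonzero A-{b} characteristic vector g is an eigenvector of A corresponding to the eigenvalue 1 (i.e., Ag = g). -/

import Mathlib

/- STATEMENT 15: Every A-{b} characteristic vector (g ∈ Z(A;b) with (A−I)g ∈ span{b})
   is a scalar multiple of m̂_b(A)b. In particular, if m_b(1) = 0 then every nonzero
   A-{b} characteristic vector g satisfies Ag = g. -/

open Polynomial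

/-- The observational orbits space `Z(A; b)` (single vector). -/
def obsOrbitSpace₁ {𝕜 : Type*} [RCLike 𝕜] {d : ℕ}
    (A : Module.End 𝕜 (EuclideanSpace 𝕜 (Fin d))) (b : EuclideanSpace 𝕜 (Fin d)) :
    Submodule 𝕜 (EuclideanSpace 𝕜 (Fin d)) :=
  Submodule.span 𝕜 {v | ∃ n : ℕ, v = (A ^ n) b}

/-- `m` is the minimal `A`-annihilating polynomial of `b`. -/
def IsMinAnnihilating {𝕜 : Type*} [RCLike 𝕜] {d : ℕ}
    (A : Module.End 𝕜 (EuclideanSpace 𝕜 (Fin d))) (b : EuclideanSpace 𝕜 (Fin d))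
    (m : Polynomial 𝕜) : Prop :=
  m.Monic ∧ (aeval A m) b = 0 ∧
    ∀ p : Polynomial 𝕜, p.Monic → (aeval A p) b = 0 → m.degree ≤ p.degree

/-- `p̂(x) := (p(x) − p(1))/(x−1)`; the division is exact since `(x−1) ∣ p(x) − p(1)`. -/
noncomputable def hatPoly {𝕜 : Type*} [RCLike 𝕜] (p : Polynomial 𝕜) : Polynomial 𝕜 :=
  (p - C (p.eval 1)) /ₘ (X - C 1)

theorem hatPoly_mul_aux {𝕜 : Type*} [RCLike 𝕜] (p : Polynomial 𝕜) :
    (X - C 1) * hatPoly p = p - C (p.eval 1) := by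
  unfold hatPoly
  apply mul_divByMonic_eq_iff_isRoot.2
  simp

theorem minAnnihilating_dvd_aux {𝕜 : Type*} [RCLike 𝕜] {d : ℕ}
    (A : Module.End 𝕜 (EuclideanSpace 𝕜 (Fin d)))
    (b : EuclideanSpace 𝕜 (Fin d)) (m : Polynomial 𝕜)
    (hm : IsMinAnnihilating A b m) (q : Polynomial 𝕜) (hq : aeval A q b = 0) : m ∣ q := by
  obtain ⟨h1, h2, h3⟩ := hm
  rw [← modByMonic_eq_zero_iff_dvd h1]
  by_contra hr
  have hdeg := degree_modByMonic_lt q h1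
  have hrb : aeval A (q %ₘ m) b = 0 := by
    have h := modByMonic_add_div q m
    rw [← h, mul_comm, map_add, map_mul] at hq
    simpa [h2] using hq
  have h4 := h3 _ (monic_mul_leadingCoeff_inv hr) (by
    rw [mul_comm, map_mul]; simp [hrb])
  rw [degree_mul_leadingCoeff_inv _ hr] at h4
  exact absurd hdeg (not_lt.2 h4)

theorem characteristic_vector_single {𝕜 : Type*} [RCLike 𝕜] {d : ℕ}
    (A : Module.End 𝕜 (EuclideanSpace 𝕜 (Fin d)))
    (b : EuclideanSpace 𝕜 (Fin d)) (m : Polynomial 𝕜)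
    (hm : IsMinAnnihilating A b m)
    (g : EuclideanSpace 𝕜 (Fin d)) (hgZ : g ∈ obsOrbitSpace₁ A b)
    (hgC : (A - 1) g ∈ Submodule.span 𝕜 {b}) :
    (∃ a : 𝕜, g = a • (aeval A (hatPoly m)) b) ∧
    (m.eval 1 = 0 → g ≠ 0 → A g = g) := by
  have hp : ∃ p : Polynomial 𝕜, g = aeval A p b := by
    clear hgC
    unfold obsOrbitSpace₁ at hgZ
    induction hgZ using Submodule.span_induction with
    | mem x hx =>
      obtain ⟨n, rfl⟩ := hx
      exact ⟨X ^ n, by simp⟩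
    | zero => exact ⟨0, by simp⟩
    | add x y _ _ hx hy =>
      obtain ⟨p, rfl⟩ := hx
      obtain ⟨q, rfl⟩ := hy
      exact ⟨p + q, by simp⟩
    | smul a x _ hx =>
      obtain ⟨p, rfl⟩ := hx
      exact ⟨a • p, by simp⟩
  obtain ⟨p, rfl⟩ := hp
  obtain ⟨c, hc⟩ := Submodule.mem_span_singleton.1 hgC
  obtain ⟨s, hs⟩ := minAnnihilating_dvd_aux A b m hm ((X - C 1) * p - C c) (by
    rw [map_sub, map_mul]
    simp only [LinearMap.sub_apply, Module.End.mul_apply, map_sub, aeval_X, aeval_C, map_one]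
    simp only [LinearMap.sub_apply] at hc
    rw [← hc]
    simp [Module.algebraMap_end_apply])
  have he : - c = m.eval 1 * s.eval 1 := by
    simpa using congrArg (eval 1) hs
  have hpe : p = hatPoly s * m + C (s.eval 1) * hatPoly m := by
    have hX : (X - C 1 : Polynomial 𝕜) ≠ 0 := X_sub_C_ne_zero 1
    apply mul_left_cancel₀ hX
    have e1 := hatPoly_mul_aux s
    have e2 := hatPoly_mul_aux m
    have e3 := congrArg C he
    rw [C_neg, C_mul] at e3
    linear_combination hs - m * e1 - C (s.eval 1) * e2 - e3
  have hg : aeval A p b = s.eval 1 • aeval A (hatPoly m) b := by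
    rw [hpe, map_add, map_mul, map_mul]
    simp [hm.2.1, Module.algebraMap_end_apply]
  refine ⟨⟨_, hg⟩, fun h1 _ => ?_⟩
  have h := congrArg (fun q => aeval A q b) (hatPoly_mul_aux m)
  simp only [h1, map_zero, sub_zero, hm.2.1, map_mul, map_sub, aeval_X, map_one,
    Module.End.mul_apply, LinearMap.sub_apply, Module.End.one_apply] at h
  rw [hg, map_smul, sub_eq_zero.1 h]
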